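/- Let k ≥ 0, ℓ ≥ 1 and λ ∈ P_ℓ^k. Then: (a) for every x ∈ [1, bot_λ], the pair (x, k − λ_x + x + 1) lies in Δ^k(λ) and is a removable root of Δ^k(λ); in particular down_λ(x) is defined and down_λ(x) = k − λ_x + x + 1; and (b) for every x ∈ [ℓ] there exists c ≥ 0 such that down_λ^c(x) ∈ [bot_λ + 1, ℓ], i.e. iterating down_λ from any x eventually leaves [1, bot_λ]. -/

import Mathlib

open scoped Classical

noncomputable section

/-- The ambient ring: formal power series over ℚ in countably many variables. -/
abbrev R : Type := MvPowerSeries ℕ ℚ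

/-- The complete homogeneous symmetric function `h_m` (equal to `0` for `m < 0`):
its coefficient at a monomial is `1` if the monomial has total degree `m`, else `0`. -/
def hh (m : ℤ) : R := fun d => if ((d.sum fun _ e => (e : ℤ)) = m) then 1 else 0

/-- The inhomogeneous analogue `k_m^{(r)} = ∑_{i=0}^{m} C(r+i−1, i) · h_{m−i}`. -/
def kk (r : ℕ) (m : ℤ) : R :=
  ∑ i ∈ Finset.range (m.toNat + 1), ((r + i - 1).choose i : ℚ) • hh (m - (i : ℤ))

/-- The dual stable Grothendieck polynomial `g_γ`, as an `ℓ × ℓ` determinant with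
`(i,j)` entry `k_{γ_i + j − i}^{(i−1)}` (indices 1-based). -/
def gg (ℓ : ℕ) (γ : ℕ → ℤ) : R :=
  (Matrix.of fun i j : Fin ℓ =>
    kk i.val (γ (i.val + 1) + (j.val : ℤ) - (i.val : ℤ))).det

/-- The `i`-th standard basis vector `ε_i`. -/
def eps (i : ℕ) : ℕ → ℤ := fun x => if x = i then 1 else 0

/-- The Katalan function `K(Ψ; M; γ)`. -/
def katalan (ℓ : ℕ) (Ψ : Finset (ℕ × ℕ)) (M : Multiset ℕ) (γ : ℕ → ℤ) : R :=
  (M.powerset.map fun S =>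
    (-1 : R) ^ Multiset.card S *
      ∑ᶠ α : {p // p ∈ Ψ} → ℕ,
        gg ℓ (fun x =>
          γ x + (∑ p ∈ Ψ.attach, (α p : ℤ) * (eps p.1.1 x - eps p.1.2 x))
            - (S.map fun z => eps z x).sum)).sum

/-- The set of positive roots `Δ_ℓ^+ = {(i,j) : 1 ≤ i < j ≤ ℓ}`. -/
def DeltaPlus (ℓ : ℕ) : Finset (ℕ × ℕ) :=
  (Finset.Icc 1 ℓ ×ˢ Finset.Icc 1 ℓ).filter fun p => p.1 < p.2

/-- A root ideal: an upper order ideal of `Δ_ℓ^+`. -/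
def IsRootIdeal (ℓ : ℕ) (Ψ : Finset (ℕ × ℕ)) : Prop :=
  Ψ ⊆ DeltaPlus ℓ ∧
    ∀ a b c d : ℕ, (a, b) ∈ Ψ → (c, d) ∈ DeltaPlus ℓ → c ≤ a → b ≤ d → (c, d) ∈ Ψ

/-- The root ideal `Δ^k(λ) = {(i,j) ∈ Δ_ℓ^+ : j > k − λ_i + i}`. -/
def DeltaK (k ℓ : ℕ) (lam : ℕ → ℤ) : Finset (ℕ × ℕ) :=
  (DeltaPlus ℓ).filter fun p => (k : ℤ) - lam p.1 + (p.1 : ℤ) < (p.2 : ℤ)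

/-- `bot(Ψ)`: the largest `x` such that row `x` of `Ψ` is nonempty (`0` if `Ψ = ∅`). -/
def botIdeal (Ψ : Finset (ℕ × ℕ)) : ℕ := Ψ.sup Prod.fst

/-- `bot_λ := bot(Δ^k(λ))`. -/
def botL (k ℓ : ℕ) (lam : ℕ → ℤ) : ℕ := botIdeal (DeltaK k ℓ lam)

/-- A removable root of a root ideal. -/
def IsRemovable (ℓ : ℕ) (Ψ : Finset (ℕ × ℕ)) (α : ℕ × ℕ) : Prop :=
  α ∈ Ψ ∧ IsRootIdeal ℓ (Ψ.erase α)

/-- `down_Ψ(x)` is defined, i.e. row `x` of `Ψ` contains a removable root. -/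
def HasDown (ℓ : ℕ) (Ψ : Finset (ℕ × ℕ)) (x : ℕ) : Prop :=
  ∃ j, IsRemovable ℓ Ψ (x, j)

/-- `down_Ψ(x)`: the column of the removable root in row `x` (junk value `0` if
row `x` has no removable root). -/
def down (ℓ : ℕ) (Ψ : Finset (ℕ × ℕ)) (x : ℕ) : ℕ :=
  ((Ψ.filter fun p => p.1 = x ∧ IsRemovable ℓ Ψ p).image Prod.snd).sup id

/-- `down_λ := down_{Δ^k(λ)}`. -/
def downL (k ℓ : ℕ) (lam : ℕ → ℤ) : ℕ → ℕ := down ℓ (DeltaK k ℓ lam)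

/-- The `a`-fold iterate `down_Ψ^a(x)` is defined. -/
def DownIterDefined (ℓ : ℕ) (Ψ : Finset (ℕ × ℕ)) (a x : ℕ) : Prop :=
  ∀ b < a, HasDown ℓ Ψ ((down ℓ Ψ)^[b] x)

/-- `L(ℛ)`: the multiset of second components of `ℛ`, with multiplicity. -/
def Lmul (ℛ : Finset (ℕ × ℕ)) : Multiset ℕ := ℛ.val.map Prod.snd

/-- `λ ∈ P_ℓ^k`: a `k`-bounded partition with `ℓ` parts allowed to be zero. -/
def IsKBounded (k ℓ : ℕ) (lam : ℕ → ℤ) : Prop :=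
  lam 1 ≤ (k : ℤ) ∧ (∀ i, 1 ≤ i → i < ℓ → lam (i + 1) ≤ lam i) ∧ 0 ≤ lam ℓ

/-- The multiset `M_z(λ)`: `L(Δ^k(λ))` with one occurrence of `down_λ(x)` removed
for each `x ∈ [z, bot_λ]`. -/
def Mz (k ℓ : ℕ) (lam : ℕ → ℤ) (z : ℕ) : Multiset ℕ :=
  Lmul (DeltaK k ℓ lam) - ((Finset.Icc z (botL k ℓ lam)).val.map (downL k ℓ lam))

/-- The `K`-`k`-Schur function of weight `z`: `ĝ_λ^{(z)} = K(Δ^k(λ); M_z(λ); λ)`. -/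
def wkschur (k ℓ : ℕ) (lam : ℕ → ℤ) (z : ℕ) : R :=
  katalan ℓ (DeltaK k ℓ lam) (Mz k ℓ lam z) lam

/-- The `K`-`k`-Schur function `g_λ^{(k)} = K(Δ^k(λ); L(Δ^{k+1}(λ)); λ)`. -/
def kkschur (k ℓ : ℕ) (lam : ℕ → ℤ) : R :=
  katalan ℓ (DeltaK k ℓ lam) (Lmul (DeltaK (k + 1) ℓ lam)) lam

/-- The closed `k`-Schur Katalan function `𝔤_λ^{(k)} = K(Δ^k(λ); L(Δ^k(λ)); λ)`. -/
def closedkschur (k ℓ : ℕ) (lam : ℕ → ℤ) : R :=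
  katalan ℓ (DeltaK k ℓ lam) (Lmul (DeltaK k ℓ lam)) lam

/-- `|λ| = λ_1 + ⋯ + λ_ℓ`. -/
def psize (ℓ : ℕ) (lam : ℕ → ℤ) : ℤ := ∑ i ∈ Finset.Icc 1 ℓ, lam i

theorem mem_DeltaK {k ℓ : ℕ} {lam : ℕ → ℤ} {i j : ℕ} :
    (i, j) ∈ DeltaK k ℓ lam ↔
      1 ≤ i ∧ i < j ∧ j ≤ ℓ ∧ (k : ℤ) - lam i + (i : ℤ) < (j : ℤ) := by
  simp only [DeltaK, DeltaPlus, Finset.mem_filter, Finset.mem_product, Finset.mem_Icc]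
  constructor
  · rintro ⟨⟨⟨⟨h1, h2⟩, h3, h4⟩, h5⟩, h6⟩
    exact ⟨h1, h5, h4, h6⟩
  · rintro ⟨h1, h2, h3, h4⟩
    exact ⟨⟨⟨⟨h1, by omega⟩, by omega, h3⟩, h2⟩, h4⟩

theorem mem_DeltaPlus {ℓ i j : ℕ} : (i, j) ∈ DeltaPlus ℓ ↔ 1 ≤ i ∧ i < j ∧ j ≤ ℓ := by
  simp only [DeltaPlus, Finset.mem_filter, Finset.mem_product, Finset.mem_Icc]
  omega

theorem IsKBounded.antitone {k ℓ : ℕ} {lam : ℕ → ℤ} (hlam : IsKBounded k ℓ lam) {x y : ℕ}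
    (hx : 1 ≤ x) (hxy : x ≤ y) (hy : y ≤ ℓ) : lam y ≤ lam x := by
  induction y, hxy using Nat.le_induction with
  | base => exact le_rfl
  | succ n hn ih => exact (hlam.2.1 n (hx.trans hn) hy).trans (ih (by omega))

theorem IsKBounded.le {k ℓ : ℕ} {lam : ℕ → ℤ} (hlam : IsKBounded k ℓ lam) {x : ℕ}
    (hx : 1 ≤ x) (hxℓ : x ≤ ℓ) : lam x ≤ k :=
  (hlam.antitone le_rfl hx hxℓ).trans hlam.1

/-- The bottom row of a root ideal with a nonzero `bot` is nonempty. -/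
theorem exists_mem_of_botIdeal_pos {Ψ : Finset (ℕ × ℕ)} (h : 1 ≤ botIdeal Ψ) :
    ∃ j, (botIdeal Ψ, j) ∈ Ψ := by
  have hne : Ψ.Nonempty := by
    by_contra hne
    simp [Finset.not_nonempty_iff_eq_empty.mp hne, botIdeal] at h
  obtain ⟨⟨y, j⟩, hp, hsup⟩ := Finset.exists_mem_eq_sup Ψ hne Prod.fst
  have hbot : botIdeal Ψ = y := hsup
  exact ⟨j, hbot ▸ hp⟩

/-- A row of a root ideal contains at most one removable root. -/
theorem IsRemovable.snd_unique {ℓ : ℕ} {Ψ : Finset (ℕ × ℕ)} (hΨ : Ψ ⊆ DeltaPlus ℓ) {x i j : ℕ}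
    (hi : IsRemovable ℓ Ψ (x, i)) (hj : IsRemovable ℓ Ψ (x, j)) : i = j := by
  wlog hij : i ≤ j generalizing i j
  · exact (this hj hi (by omega)).symm
  by_contra hne
  have hmem : (x, i) ∈ Ψ.erase (x, j) := Finset.mem_erase.mpr ⟨by simpa using hne, hi.1⟩
  exact Finset.notMem_erase _ _ (hj.2.2 x i x j hmem (hΨ hj.1) le_rfl hij)

theorem IsRemovable.down_eq {ℓ : ℕ} {Ψ : Finset (ℕ × ℕ)} (hΨ : Ψ ⊆ DeltaPlus ℓ) {x j : ℕ}
    (hj : IsRemovable ℓ Ψ (x, j)) : down ℓ Ψ x = j := by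
  apply le_antisymm
  · refine Finset.sup_le fun i hi => ?_
    obtain ⟨⟨y, z⟩, hp, rfl⟩ := Finset.mem_image.mp hi
    obtain ⟨-, rfl, hrem⟩ := Finset.mem_filter.mp hp
    exact (hrem.snd_unique hΨ hj).le
  · exact Finset.le_sup (f := id)
      (Finset.mem_image.mpr ⟨(x, j), Finset.mem_filter.mpr ⟨hj.1, rfl, hj⟩, rfl⟩)

theorem DeltaK_subset (k ℓ : ℕ) (lam : ℕ → ℤ) : DeltaK k ℓ lam ⊆ DeltaPlus ℓ :=
  Finset.filter_subset _ _

theorem mem_DeltaK_of_le_botL {k ℓ : ℕ} {lam : ℕ → ℤ} (hlam : IsKBounded k ℓ lam) {x : ℕ}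
    (hx : 1 ≤ x) (hxb : x ≤ botL k ℓ lam) :
    (x, ((k : ℤ) - lam x + (x : ℤ) + 1).toNat) ∈ DeltaK k ℓ lam := by
  obtain ⟨j, hj⟩ := exists_mem_of_botIdeal_pos (hx.trans hxb)
  change (botL k ℓ lam, j) ∈ _ at hj
  obtain ⟨h1, h2, h3, h4⟩ := mem_DeltaK.mp hj
  have hanti := hlam.antitone hx hxb (by omega)
  have hle := hlam.le hx (by omega)
  exact mem_DeltaK.mpr ⟨hx, by omega, by omega, by omega⟩

/-- The leftmost root of a row of `Δ^k(λ)` is removable. -/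
theorem isRemovable_of_mem_DeltaK {k ℓ : ℕ} {lam : ℕ → ℤ} (hlam : IsKBounded k ℓ lam) {x : ℕ}
    (hmem : (x, ((k : ℤ) - lam x + (x : ℤ) + 1).toNat) ∈ DeltaK k ℓ lam) :
    IsRemovable ℓ (DeltaK k ℓ lam) (x, ((k : ℤ) - lam x + (x : ℤ) + 1).toNat) := by
  refine ⟨hmem, (Finset.erase_subset _ _).trans (DeltaK_subset k ℓ lam), ?_⟩
  intro a b c d hab hcd hca hbd
  obtain ⟨hne, hab⟩ := Finset.mem_erase.mp hab
  obtain ⟨ha1, ha2, ha3, ha4⟩ := mem_DeltaK.mp hab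
  obtain ⟨hc1, hc2, hc3⟩ := mem_DeltaPlus.mp hcd
  have hanti := hlam.antitone hc1 hca (by omega)
  refine Finset.mem_erase.mpr ⟨fun heq => hne ?_, mem_DeltaK.mpr ⟨hc1, hc2, hc3, by omega⟩⟩
  obtain ⟨rfl, rfl⟩ := Prod.mk.inj heq
  exact Prod.ext (by dsimp only; omega) (by dsimp only; omega)

theorem exists_iterate_downL_mem {k ℓ : ℕ} {lam : ℕ → ℤ} (hlam : IsKBounded k ℓ lam) {x : ℕ}
    (hx : 1 ≤ x) (hxℓ : x ≤ ℓ) :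
    ∃ c : ℕ, (downL k ℓ lam)^[c] x ∈ Finset.Icc (botL k ℓ lam + 1) ℓ := by
  by_cases hxb : x ≤ botL k ℓ lam
  · have hmem := mem_DeltaK_of_le_botL hlam hx hxb
    have hdown : downL k ℓ lam x = _ :=
      (isRemovable_of_mem_DeltaK hlam hmem).down_eq (DeltaK_subset k ℓ lam)
    obtain ⟨-, hlt, hle, -⟩ := mem_DeltaK.mp hmem
    rw [← hdown] at hlt hle
    obtain ⟨c, hc⟩ := exists_iterate_downL_mem hlam (hx.trans hlt.le) hle
    exact ⟨c + 1, by rwa [Function.iterate_succ_apply]⟩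
  · exact ⟨0, Finset.mem_Icc.mpr ⟨by simpa using hxb, hxℓ⟩⟩
termination_by ℓ - x

/-- (a) every row `x ∈ [bot_λ]` of `Δ^k(λ)` has the removable root
`(x, k − λ_x + x + 1)`, so `down_λ(x)` is defined and equals `k − λ_x + x + 1`;
(b) iterating `down_λ` from any `x ∈ [ℓ]` eventually lands in `[bot_λ + 1, ℓ]`. -/
theorem statement12 (k ℓ : ℕ) (hℓ : 1 ≤ ℓ) (lam : ℕ → ℤ) (hlam : IsKBounded k ℓ lam) :
    (∀ x ∈ Finset.Icc 1 (botL k ℓ lam),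
      (x, ((k : ℤ) - lam x + (x : ℤ) + 1).toNat) ∈ DeltaK k ℓ lam ∧
      IsRemovable ℓ (DeltaK k ℓ lam) (x, ((k : ℤ) - lam x + (x : ℤ) + 1).toNat) ∧
      HasDown ℓ (DeltaK k ℓ lam) x ∧
      downL k ℓ lam x = ((k : ℤ) - lam x + (x : ℤ) + 1).toNat) ∧
    (∀ x ∈ Finset.Icc 1 ℓ, ∃ c : ℕ,
      (downL k ℓ lam)^[c] x ∈ Finset.Icc (botL k ℓ lam + 1) ℓ) := by
  refine ⟨fun x hx => ?_, fun x hx => ?_⟩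
  · obtain ⟨hx1, hxb⟩ := Finset.mem_Icc.mp hx
    have hmem := mem_DeltaK_of_le_botL hlam hx1 hxb
    have hrem := isRemovable_of_mem_DeltaK hlam hmem
    exact ⟨hmem, hrem, ⟨_, hrem⟩, hrem.down_eq (DeltaK_subset k ℓ lam)⟩
  · obtain ⟨hx1, hxℓ⟩ := Finset.mem_Icc.mp hx
    exact exists_iterate_downL_mem hlam hx1 hxℓ

end
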